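/- Fix ε ∈ (0, 1/2] and let v₀(x) = x − x² be the true Poiseuille profile. Suppose v : (−∞, 1] → ℝ is bounded, continuously differentiable, satisfies v''(x) = −2 for ε < x < 1, ε²·v''(x) = v(x) − 2ε² for x < ε (the mask shifted into the fluid by ℓ = ε), and v(1) = 0. Then on the fluid region the solution is v(x) = −x² + (1 − ε²)·x + ε² for ε ≤ x ≤ 1, and the penalization error satisfies sup_{x∈[ε,1]} |v(x) − v₀(x)| ≤ ε². That is, shifting the discontinuous mask by its displacement length promotes the error in penalized Poiseuille flow from O(ε) to O(ε²). -/

import Mathlib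

open Real Filter Set

lemma const_aux {f : ℝ → ℝ} {a b : ℝ} (hab : a ≤ b) (hc : ContinuousOn f (Icc a b))
    (hd : ∀ x ∈ Ioo a b, HasDerivAt f 0 x) : f b = f a := by
  rcases hab.eq_or_lt with h | h
  · rw [h]
  · obtain ⟨c, _, hc'⟩ := exists_hasDerivAt_eq_slope f (fun _ => 0) h hc hd
    have : b - a ≠ 0 := by linarith
    field_simp at hc'
    linarith

/-- penalized Poiseuille flow with the discontinuous mask shifted into the
fluid by its displacement length `ℓ = ε`. Any bounded `C¹` solution of `v'' = -2` on
`(ε,1)`, `ε² v'' = v - 2ε²` on `(-∞,ε)`, with `v(1) = 0`, equals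
`-x² + (1-ε²) x + ε²` on the fluid region `[ε,1]`, and the error against the true
profile `v₀(x) = x - x²` there is at most `ε²`: the shift promotes the error from
`O(ε)` to `O(ε²)`. -/
theorem poiseuille_shifted_mask_error
    {ε : ℝ} (hε : ε ∈ Ioc (0 : ℝ) (1 / 2))
    {v : ℝ → ℝ}
    (hbdd : ∃ M : ℝ, ∀ x : ℝ, x ≤ 1 → |v x| ≤ M)
    (hC1 : ContDiffOn ℝ 1 v (Iic 1))
    (hfluid : ∀ x ∈ Ioo ε 1, HasDerivAt (deriv v) (-2) x)
    (hsolid : ∀ x : ℝ, x < ε →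
      ∃ d : ℝ, HasDerivAt (deriv v) d x ∧ ε ^ 2 * d = v x - 2 * ε ^ 2)
    (hbc : v 1 = 0) :
    (∀ x ∈ Icc ε 1, v x = -x ^ 2 + (1 - ε ^ 2) * x + ε ^ 2) ∧
    (∀ x ∈ Icc ε 1, |v x - (x - x ^ 2)| ≤ ε ^ 2) := by
  obtain ⟨h0, h1⟩ := hε
  obtain ⟨M, hM⟩ := hbdd
  have hcv : ContinuousOn v (Iic 1) := hC1.continuousOn
  have hC1' : ContDiffOn ℝ 1 v (Iio 1) := hC1.mono Iio_subset_Iic_self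
  have hcd : ContinuousOn (deriv v) (Iio 1) :=
    hC1'.continuousOn_deriv_of_isOpen isOpen_Iio le_rfl
  have hdv : ∀ x < 1, HasDerivAt v (deriv v x) x := fun x hx =>
    ((hC1'.differentiableOn one_ne_zero).differentiableAt (isOpen_Iio.mem_nhds hx)).hasDerivAt
  have hne : ε ≠ 0 := h0.ne'
  have hexp : ∀ s x : ℝ, HasDerivAt (fun x => Real.exp (s * x)) (s * Real.exp (s * x)) x := by
    intro s x
    have := ((hasDerivAt_id x).const_mul s).exp
    simpa [mul_comm] using this
  have key : ∀ s : ℝ, (s * ε) ^ 2 = 1 → ∀ x ≤ ε,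
      (deriv v ε - s * (v ε - 2 * ε ^ 2)) * Real.exp (s * ε)
        = (deriv v x - s * (v x - 2 * ε ^ 2)) * Real.exp (s * x) := by
    intro s hs x hx
    have hsub1 : Icc x ε ⊆ Iio 1 := fun y hy => by
      have := hy.2
      simp only [mem_Iio]; linarith
    have hsub2 : Icc x ε ⊆ Iic 1 := hsub1.trans Iio_subset_Iic_self
    refine const_aux (f := fun x => (deriv v x - s * (v x - 2 * ε ^ 2)) * Real.exp (s * x)) hx ?_ ?_
    · have c1 := hcd.mono hsub1
      have c2 := hcv.mono hsub2
      fun_prop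
    · intro y hy
      obtain ⟨d, hd, he⟩ := hsolid y hy.2
      have hy1 : y < 1 := by linarith [hy.2]
      have := (hd.sub (((hdv y hy1).sub_const (2 * ε ^ 2)).const_mul s)).mul (hexp s y)
      refine this.congr_deriv ?_
      have hd' : d = s ^ 2 * (v y - 2 * ε ^ 2) := by
        rw [← he]
        linear_combination (-d) * hs
      simp only [Pi.sub_apply]
      rw [hd']
      ring
  have hslope : deriv v ε - ε⁻¹ * (v ε - 2 * ε ^ 2) = 0 := by
    have k1 := key ε⁻¹ (by field_simp)
    have k2 := key (-ε⁻¹) (by field_simp)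
    set C := (deriv v ε - ε⁻¹ * (v ε - 2 * ε ^ 2)) * Real.exp (ε⁻¹ * ε) with hC
    set D := (deriv v ε - -ε⁻¹ * (v ε - 2 * ε ^ 2)) * Real.exp (-ε⁻¹ * ε) with hD
    have hi : 0 < ε⁻¹ := inv_pos.mpr h0
    have hlim : Tendsto (fun x => Real.exp (ε⁻¹ * x)) atBot (nhds 0) :=
      Real.tendsto_exp_atBot.comp (tendsto_id.const_mul_atBot hi)
    have hlim2 : Tendsto (fun x => |D| * Real.exp (ε⁻¹ * x) * Real.exp (ε⁻¹ * x)
        + 2 * ε⁻¹ * (M + 2 * ε ^ 2) * Real.exp (ε⁻¹ * x)) atBot (nhds 0) := by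
      simpa using ((hlim.const_mul |D|).mul hlim).add
        (hlim.const_mul (2 * ε⁻¹ * (M + 2 * ε ^ 2)))
    have hle : |C| ≤ 0 := by
      refine ge_of_tendsto hlim2 ?_
      filter_upwards [eventually_le_atBot ε] with x hx
      have e1 := k1 x hx
      have e2 := k2 x hx
      have hE : Real.exp (-ε⁻¹ * x) * Real.exp (ε⁻¹ * x) = 1 := by
        rw [← Real.exp_add]; simp
      have hEp := Real.exp_pos (ε⁻¹ * x)
      set E := Real.exp (ε⁻¹ * x)
      have hCe : C = D * E * E - 2 * ε⁻¹ * (v x - 2 * ε ^ 2) * E := by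
        rw [e1, e2]
        linear_combination (-(deriv v x - -ε⁻¹ * (v x - 2 * ε ^ 2)) * E) * hE
      have hb : |v x - 2 * ε ^ 2| ≤ M + 2 * ε ^ 2 := by
        have := abs_le.mp (hM x (by linarith))
        have := sq_nonneg ε
        rw [abs_le]; constructor <;> linarith
      calc |C| ≤ |D * E * E| + |2 * ε⁻¹ * (v x - 2 * ε ^ 2) * E| := by
            rw [hCe]; exact abs_sub _ _
        _ = |D| * E * E + 2 * ε⁻¹ * |v x - 2 * ε ^ 2| * E := by
            simp only [abs_mul, abs_of_pos hEp, abs_of_pos hi, abs_two]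
        _ ≤ _ := by gcongr
    have : C = 0 := abs_eq_zero.mp (le_antisymm hle (abs_nonneg _))
    rw [hC] at this
    exact (mul_eq_zero.mp this).resolve_right (Real.exp_pos _).ne'
  have hfl : ∀ x ∈ Ico ε 1, deriv v x + 2 * x = deriv v ε + 2 * ε := by
    intro x hx
    refine const_aux (f := fun x => deriv v x + 2 * x) hx.1 ?_ ?_
    · have c1 := hcd.mono (fun y (hy : y ∈ Icc ε x) => lt_of_le_of_lt hy.2 hx.2)
      fun_prop
    · intro y hy
      have := (hfluid y ⟨hy.1, hy.2.trans hx.2⟩).add ((hasDerivAt_id y).const_mul 2)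
      exact this.congr_deriv (by norm_num)
  set b := deriv v ε + 2 * ε with hb
  have hv : ∀ x ∈ Icc ε 1, v 1 + 1 ^ 2 - b * 1 = v x + x ^ 2 - b * x := by
    intro x hx
    refine const_aux (f := fun x => v x + x ^ 2 - b * x) hx.2 ?_ ?_
    · have c1 := hcv.mono (fun y (hy : y ∈ Icc x 1) => hy.2)
      fun_prop
    · intro y hy
      have := ((hdv y hy.2).add (hasDerivAt_pow 2 y)).sub ((hasDerivAt_id y).const_mul b)
      refine this.congr_deriv ?_
      have := hfl y ⟨hx.1.trans hy.1.le, hy.2⟩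
      norm_num
      linarith
  have hbval : b = 1 - ε ^ 2 := by
    have := hv ε ⟨le_rfl, by linarith⟩
    rw [hbc] at this
    have h3 : ε * deriv v ε = v ε - 2 * ε ^ 2 := by
      field_simp at hslope
      linarith
    have h4 : ε * b = ε * deriv v ε + 2 * ε ^ 2 := by rw [hb]; ring
    linarith
  have hmain : ∀ x ∈ Icc ε 1, v x = -x ^ 2 + (1 - ε ^ 2) * x + ε ^ 2 := by
    intro x hx
    have := hv x hx
    rw [hbc, hbval] at this
    linarith
  refine ⟨hmain, fun x hx => ?_⟩
  rw [hmain x hx]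
  have hx0 : 0 ≤ x := h0.le.trans hx.1
  have hx1 := hx.2
  have := sq_nonneg ε
  rw [abs_le]; constructor <;> nlinarith
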